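/- Let ξ ∈ ℝ with −α < ξ < 0 and Λ G(ξ) < λ G(α), and let u ∈ C²([0,R)) be the solution of the Cauchy problem M⁻(u'') + g(u) = 0, u(0) = ξ, u'(0) = 0 on its maximal interval of existence [0,R). Then R = +∞, u is oscillating (it has an unbounded sequence of zeros), u is periodic, and sup_{r ≥ 0} |u(r)| = u(r₂) < α, where r₂ is the first critical point of u in (0,+∞), which is a local maximizer of u. -/

import Mathlib

open Set Filter Topology

/-- `(x, y)` is a forward solution on `[a, b]` of the system `x' = y`, `y' = f x`. -/
structure IsForwardSolution (f x y : ℝ → ℝ) (a b : ℝ) : Prop where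
  continuousOn_fst : ContinuousOn x (Icc a b)
  continuousOn_snd : ContinuousOn y (Icc a b)
  deriv_fst : ∀ t ∈ Ico a b, HasDerivWithinAt x (y t) (Ici t) t
  deriv_snd : ∀ t ∈ Ico a b, HasDerivWithinAt y (f (x t)) (Ici t) t

namespace IsForwardSolution

variable {f x y : ℝ → ℝ} {a b : ℝ}

theorem of_hasDerivWithinAt
    (h : ∀ t ∈ Icc a b,
      HasDerivWithinAt x (y t) (Ici a) t ∧ HasDerivWithinAt y (f (x t)) (Ici a) t) :
    IsForwardSolution f x y a b where
  continuousOn_fst t ht := (h t ht).1.continuousWithinAt.mono Icc_subset_Ici_self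
  continuousOn_snd t ht := (h t ht).2.continuousWithinAt.mono Icc_subset_Ici_self
  deriv_fst t ht := (h t ⟨ht.1, ht.2.le⟩).1.mono (Ici_subset_Ici.2 ht.1)
  deriv_snd t ht := (h t ⟨ht.1, ht.2.le⟩).2.mono (Ici_subset_Ici.2 ht.1)

theorem eqOn {K : NNReal} (hf : LipschitzWith K f) {x' y' : ℝ → ℝ}
    (h : IsForwardSolution f x y a b) (h' : IsForwardSolution f x' y' a b)
    (hx : x a = x' a) (hy : y a = y' a) : EqOn x x' (Icc a b) ∧ EqOn y y' (Icc a b) := by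
  have hv : ∀ _ : ℝ, LipschitzWith (max 1 (K * 1)) (fun p : ℝ × ℝ => (p.2, f p.1)) := fun _ =>
    LipschitzWith.prod_snd.prodMk (hf.comp LipschitzWith.prod_fst)
  have key := ODE_solution_unique hv (f := fun t => (x t, y t)) (g := fun t => (x' t, y' t))
    (h.continuousOn_fst.prodMk h.continuousOn_snd)
    (fun t ht => (h.deriv_fst t ht).prodMk (h.deriv_snd t ht))
    (h'.continuousOn_fst.prodMk h'.continuousOn_snd)
    (fun t ht => (h'.deriv_fst t ht).prodMk (h'.deriv_snd t ht)) (Prod.ext hx hy)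
  exact ⟨fun t ht => congrArg Prod.fst (key ht), fun t ht => congrArg Prod.snd (key ht)⟩

theorem energy (hf : Continuous f) (h : IsForwardSolution f x y a b) {t : ℝ} (ht : t ∈ Icc a b) :
    y t ^ 2 / 2 - ∫ s in (0 : ℝ)..x t, f s = y a ^ 2 / 2 - ∫ s in (0 : ℝ)..x a, f s := by
  have hW : ∀ z, HasDerivAt (fun z => ∫ s in (0 : ℝ)..z, f s) (f z) z := fun z =>
    hf.integral_hasStrictDerivAt 0 z |>.hasDerivAt
  have hWc : Continuous (fun z => ∫ s in (0 : ℝ)..z, f s) :=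
    continuous_iff_continuousAt.2 fun z => (hW z).continuousAt
  refine constant_of_has_deriv_right_zero
    (f := fun t => y t ^ 2 / 2 - ∫ s in (0 : ℝ)..x t, f s) ?_ ?_ t ht
  · exact ((h.continuousOn_snd.pow 2).div_const 2).sub (hWc.comp_continuousOn h.continuousOn_fst)
  · intro s hs
    have h1 := (((h.deriv_snd s hs).pow 2).div_const 2).sub
      ((hW (x s)).comp_hasDerivWithinAt s (h.deriv_fst s hs))
    refine h1.congr_deriv ?_
    push_cast
    ring

end IsForwardSolution

theorem exists_solution_of_lipschitz_bounded {f : ℝ → ℝ} {K L : NNReal} (hf : LipschitzWith K f)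
    (hL : ∀ t, |f t| ≤ L) (T : NNReal) (ξ : ℝ) :
    ∃ x y : ℝ → ℝ, x 0 = ξ ∧ y 0 = 0 ∧
      ∀ t ∈ Ioo (-T : ℝ) T, HasDerivAt x (y t) t ∧ HasDerivAt y (f (x t)) t := by
  have hM : -((L * T : NNReal) : ℝ) ≤ (L * T : NNReal) := by
    have := (L * T).2
    simp only [NNReal.val_eq_coe] at this
    linarith
  set c : ℝ → ℝ := fun s => projIcc _ _ hM s with hc
  have hcl : LipschitzWith 1 c := (LipschitzWith.projIcc hM)
  have hv : LipschitzWith (max (1 * 1) (K * 1)) (fun p : ℝ × ℝ => (c p.2, f p.1)) :=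
    (hcl.comp LipschitzWith.prod_snd).prodMk (hf.comp LipschitzWith.prod_fst)
  have h0 : (0 : ℝ) ∈ Icc (-T : ℝ) T := ⟨by simp, by simp⟩
  have hPL : IsPicardLindelof (fun _ : ℝ => fun p : ℝ × ℝ => (c p.2, f p.1))
      (⟨0, h0⟩ : Icc (-T : ℝ) T) (ξ, 0) (max (L * T) L * T) 0 (max (L * T) L)
      (max (1 * 1) (K * 1)) :=
    { lipschitzOnWith := fun _ _ => hv.lipschitzOnWith
      continuousOn := fun _ _ => continuousOn_const
      norm_le := by
        intro _ _ p _
        rw [Prod.norm_def]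
        push_cast
        refine max_le_max ?_ (hL _)
        have := (projIcc _ _ hM p.2).2
        rw [Real.norm_eq_abs, abs_le]
        exact_mod_cast this
      mul_max_le := by simp }
  obtain ⟨p, hp0, hp⟩ := hPL.exists_eq_forall_mem_Icc_hasDerivWithinAt
    (Metric.mem_closedBall_self le_rfl)
  have hd : ∀ t ∈ Icc (-T : ℝ) T,
      HasDerivWithinAt (fun t => (p t).1) (c (p t).2) (Icc (-T : ℝ) T) t ∧
      HasDerivWithinAt (fun t => (p t).2) (f (p t).1) (Icc (-T : ℝ) T) t := fun t ht =>
    ⟨(hp t ht).fst, (hp t ht).snd⟩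
  have hp0' : p 0 = (ξ, 0) := hp0
  have hb : ∀ t ∈ Icc (-T : ℝ) T, c (p t).2 = (p t).2 := by
    intro t ht
    have := Convex.norm_image_sub_le_of_norm_hasDerivWithin_le (fun t ht => (hd t ht).2)
      (fun t _ => hL _) (convex_Icc _ _) h0 ht
    simp only [hp0', sub_zero, Real.norm_eq_abs] at this
    have h2 : |(p t).2| ≤ (L * T : NNReal) := by
      push_cast
      exact this.trans (mul_le_mul_of_nonneg_left (abs_le.2 ht) L.2)
    simp only [hc]
    rw [projIcc_of_mem hM (abs_le.1 h2)]
  refine ⟨fun t => (p t).1, fun t => (p t).2, by simp [hp0'], by simp [hp0'], fun t ht => ?_⟩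
  have hn : Icc (-T : ℝ) T ∈ 𝓝 t := Icc_mem_nhds ht.1 ht.2
  have := hd t ⟨ht.1.le, ht.2.le⟩
  rw [hb t ⟨ht.1.le, ht.2.le⟩] at this
  exact ⟨this.1.hasDerivAt hn, this.2.hasDerivAt hn⟩

/-- A force `f` for which `ξ < 0` lies in the potential well `(-α, α)` with minimum at `0`,
at an energy level below the rims of the well and not reached before `-ξ` on the right. -/
structure IsPotentialWell (f : ℝ → ℝ) (α ξ : ℝ) : Prop where
  continuous : Continuous f
  pos : ∀ t, -α < t → t < 0 → 0 < f t
  neg : ∀ t, 0 < t → t < α → f t < 0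
  lt_start : -α < ξ
  start_neg : ξ < 0
  rim_lt : ∫ s in (0 : ℝ)..α, f s < ∫ s in (0 : ℝ)..ξ, f s
  start_le : ∫ s in (0 : ℝ)..ξ, f s ≤ ∫ s in (0 : ℝ)..(-ξ), f s

namespace IsPotentialWell

variable {f : ℝ → ℝ} {α ξ : ℝ}

theorem hasDerivAt (h : IsPotentialWell f α ξ) (z : ℝ) :
    HasDerivAt (fun z => ∫ s in (0 : ℝ)..z, f s) (f z) z :=
  (h.continuous.integral_hasStrictDerivAt 0 z).hasDerivAt

theorem continuous_integral (h : IsPotentialWell f α ξ) :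
    Continuous (fun z => ∫ s in (0 : ℝ)..z, f s) :=
  continuous_iff_continuousAt.2 fun z => (h.hasDerivAt z).continuousAt

theorem strictMonoOn (h : IsPotentialWell f α ξ) :
    StrictMonoOn (fun z => ∫ s in (0 : ℝ)..z, f s) (Icc (-α) 0) := by
  refine strictMonoOn_of_deriv_pos (convex_Icc _ _) h.continuous_integral.continuousOn ?_
  intro t ht
  rw [interior_Icc] at ht
  rw [(h.hasDerivAt t).deriv]
  exact h.pos t ht.1 ht.2

theorem strictAntiOn (h : IsPotentialWell f α ξ) :
    StrictAntiOn (fun z => ∫ s in (0 : ℝ)..z, f s) (Icc 0 α) := by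
  refine strictAntiOn_of_deriv_neg (convex_Icc _ _) h.continuous_integral.continuousOn ?_
  intro t ht
  rw [interior_Icc] at ht
  rw [(h.hasDerivAt t).deriv]
  exact h.neg t ht.1 ht.2

theorem left_rim_lt (h : IsPotentialWell f α ξ) :
    ∫ s in (0 : ℝ)..(-α), f s < ∫ s in (0 : ℝ)..ξ, f s :=
  h.strictMonoOn ⟨le_rfl, (h.lt_start.trans h.start_neg).le⟩ ⟨h.lt_start.le, h.start_neg.le⟩
    h.lt_start

theorem start_lt_of_lt (h : IsPotentialWell f α ξ) {z : ℝ} (hz : -α < z) (hz0 : z < ξ) :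
    ∫ s in (0 : ℝ)..z, f s < ∫ s in (0 : ℝ)..ξ, f s :=
  h.strictMonoOn ⟨hz.le, (hz0.trans h.start_neg).le⟩ ⟨h.lt_start.le, h.start_neg.le⟩ hz0

theorem integral_start_neg (h : IsPotentialWell f α ξ) : ∫ s in (0 : ℝ)..ξ, f s < 0 := by
  have := h.strictMonoOn ⟨h.lt_start.le, h.start_neg.le⟩
    ⟨(h.lt_start.trans h.start_neg).le, le_rfl⟩ h.start_neg
  simpa using this

theorem energy (h : IsPotentialWell f α ξ) {x y : ℝ → ℝ} {b : ℝ}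
    (hs : IsForwardSolution f x y 0 b) (hx : x 0 = ξ) (hy : y 0 = 0) {t : ℝ} (ht : t ∈ Icc 0 b) :
    y t ^ 2 = 2 * ((∫ s in (0 : ℝ)..x t, f s) - ∫ s in (0 : ℝ)..ξ, f s) := by
  have := hs.energy h.continuous ht
  rw [hx, hy] at this
  linarith

theorem mem_Ioo (h : IsPotentialWell f α ξ) {x y : ℝ → ℝ} {b : ℝ}
    (hs : IsForwardSolution f x y 0 b) (hx : x 0 = ξ) (hy : y 0 = 0) {t : ℝ} (ht : t ∈ Icc 0 b) :
    x t ∈ Ioo (-α) α := by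
  have hsub : Icc 0 t ⊆ Icc 0 b := Icc_subset_Icc_right ht.2
  have hne : ∀ r ∈ Icc 0 t, ∫ s in (0 : ℝ)..ξ, f s ≤ ∫ s in (0 : ℝ)..x r, f s := fun r hr => by
    have := h.energy hs hx hy (hsub hr)
    nlinarith [sq_nonneg (y r)]
  have h1 := h.lt_start
  have h2 := h.start_neg
  constructor
  · by_contra! hc
    obtain ⟨r, hr, hr'⟩ := intermediate_value_Icc' ht.1 (hs.continuousOn_fst.mono hsub)
      (show -α ∈ Icc (x t) (x 0) from ⟨hc, by rw [hx]; exact h1.le⟩)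
    have := hne r hr
    rw [hr'] at this
    exact absurd this h.left_rim_lt.not_ge
  · by_contra! hc
    obtain ⟨r, hr, hr'⟩ := intermediate_value_Icc ht.1 (hs.continuousOn_fst.mono hsub)
      (show α ∈ Icc (x 0) (x t) from ⟨by rw [hx]; linarith, hc⟩)
    have := hne r hr
    rw [hr'] at this
    exact absurd this h.rim_lt.not_ge

theorem start_le_of_solution (h : IsPotentialWell f α ξ) {x y : ℝ → ℝ} {b : ℝ}
    (hs : IsForwardSolution f x y 0 b) (hx : x 0 = ξ) (hy : y 0 = 0) {t : ℝ} (ht : t ∈ Icc 0 b) :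
    ξ ≤ x t := by
  by_contra! hc
  have := h.start_lt_of_lt (h.mem_Ioo hs hx hy ht).1 hc
  nlinarith [h.energy hs hx hy ht, sq_nonneg (y t)]

end IsPotentialWell

theorem eq_zero_of_tendsto_of_tendsto_deriv {h h' : ℝ → ℝ} {A M : ℝ}
    (hd : ∀ r > 0, HasDerivAt h (h' r) r) (hA : Tendsto h atTop (𝓝 A))
    (hM : Tendsto h' atTop (𝓝 M)) : M = 0 := by
  have hmvt : ∀ r : ℝ, ∃ c, r ≤ c ∧ (0 < r → h' c = h (r + 1) - h r) := by
    intro r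
    by_cases hr : 0 < r
    · obtain ⟨c, hc, hc'⟩ := exists_hasDerivAt_eq_slope h h' (lt_add_one r)
        (fun s hs => (hd s (hr.trans_le hs.1)).continuousAt.continuousWithinAt)
        (fun s hs => hd s (hr.trans hs.1))
      exact ⟨c, hc.1.le, fun _ => by rw [hc']; simp⟩
    · exact ⟨r, le_rfl, fun h => absurd h hr⟩
  choose c hc hc' using hmvt
  have h1 : Tendsto (fun r => h' (c r)) atTop (𝓝 M) :=
    hM.comp (tendsto_atTop_mono hc tendsto_id)
  have h2 : Tendsto (fun r => h (r + 1) - h r) atTop (𝓝 (A - A)) :=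
    (hA.comp (tendsto_atTop_add_const_right _ _ tendsto_id)).sub hA
  rw [sub_self] at h2
  refine tendsto_nhds_unique h1 (h2.congr' ?_)
  filter_upwards [eventually_gt_atTop 0] with r hr
  exact (hc' r hr).symm

/-- `(x, y)` solves `x' = y`, `y' = f x` on `[0, ∞)` with `x 0 = ξ` and `y 0 = 0`. -/
structure IsGlobalSolution (f x y : ℝ → ℝ) (ξ : ℝ) : Prop where
  fst_zero : x 0 = ξ
  snd_zero : y 0 = 0
  deriv_fst : ∀ t, 0 ≤ t → HasDerivWithinAt x (y t) (Ici 0) t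
  deriv_snd : ∀ t, 0 ≤ t → HasDerivWithinAt y (f (x t)) (Ici 0) t

namespace IsGlobalSolution

variable {f x y : ℝ → ℝ} {α ξ : ℝ}

theorem isForwardSolution (hs : IsGlobalSolution f x y ξ) {a b : ℝ} (ha : 0 ≤ a) :
    IsForwardSolution f x y a b :=
  .of_hasDerivWithinAt fun t ht =>
    ⟨(hs.deriv_fst t (ha.trans ht.1)).mono (Ici_subset_Ici.2 ha),
      (hs.deriv_snd t (ha.trans ht.1)).mono (Ici_subset_Ici.2 ha)⟩

theorem hasDerivAt_fst (hs : IsGlobalSolution f x y ξ) {t : ℝ} (ht : 0 < t) :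
    HasDerivAt x (y t) t :=
  (hs.deriv_fst t ht.le).hasDerivAt (Ici_mem_nhds ht)

theorem hasDerivAt_snd (hs : IsGlobalSolution f x y ξ) {t : ℝ} (ht : 0 < t) :
    HasDerivAt y (f (x t)) t :=
  (hs.deriv_snd t ht.le).hasDerivAt (Ici_mem_nhds ht)

theorem continuousOn_fst (hs : IsGlobalSolution f x y ξ) : ContinuousOn x (Ici 0) :=
  fun t ht => (hs.deriv_fst t ht).continuousWithinAt

theorem continuousOn_snd (hs : IsGlobalSolution f x y ξ) : ContinuousOn y (Ici 0) :=
  fun t ht => (hs.deriv_snd t ht).continuousWithinAt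

theorem energy (hs : IsGlobalSolution f x y ξ) (h : IsPotentialWell f α ξ) {t : ℝ} (ht : 0 ≤ t) :
    y t ^ 2 = 2 * ((∫ s in (0 : ℝ)..x t, f s) - ∫ s in (0 : ℝ)..ξ, f s) :=
  h.energy (hs.isForwardSolution le_rfl) hs.fst_zero hs.snd_zero ⟨ht, le_rfl⟩

theorem mem_Ioo (hs : IsGlobalSolution f x y ξ) (h : IsPotentialWell f α ξ) {t : ℝ} (ht : 0 ≤ t) :
    x t ∈ Ioo (-α) α :=
  h.mem_Ioo (hs.isForwardSolution le_rfl) hs.fst_zero hs.snd_zero ⟨ht, le_rfl⟩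

theorem start_le (hs : IsGlobalSolution f x y ξ) (h : IsPotentialWell f α ξ) {t : ℝ} (ht : 0 ≤ t) :
    ξ ≤ x t :=
  h.start_le_of_solution (hs.isForwardSolution le_rfl) hs.fst_zero hs.snd_zero ⟨ht, le_rfl⟩

theorem exists_pos_snd_near_zero (hs : IsGlobalSolution f x y ξ) (h : IsPotentialWell f α ξ) :
    ∃ δ > 0, ∀ t, 0 < t → t ≤ δ → 0 < y t := by
  have hd := hs.deriv_snd 0 le_rfl
  rw [hs.fst_zero] at hd
  have hpos := h.pos ξ h.lt_start h.start_neg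
  rw [← hasDerivWithinAt_Ioi_iff_Ici, hasDerivWithinAt_iff_tendsto_slope' (by simp)] at hd
  obtain ⟨δ, hδ, hsub⟩ :=
    mem_nhdsGT_iff_exists_Ioc_subset.1 (hd.eventually (lt_mem_nhds hpos))
  refine ⟨δ, hδ, fun t ht htδ => ?_⟩
  have hslope : 0 < slope y 0 t := hsub ⟨ht, htδ⟩
  rw [slope_def_field, hs.snd_zero, sub_zero, sub_zero] at hslope
  exact (div_pos_iff_of_pos_right ht).1 hslope

theorem exists_snd_eq_zero (hs : IsGlobalSolution f x y ξ) (h : IsPotentialWell f α ξ) :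
    ∃ t > 0, y t = 0 := by
  by_contra! hne
  obtain ⟨δ, hδ, hpos⟩ := hs.exists_pos_snd_near_zero h
  have hy : ∀ t, 0 < t → 0 < y t := by
    intro t ht
    by_contra! hc
    have hδt : δ ≤ t := by
      by_contra! hlt
      exact absurd (hpos t ht hlt.le) hc.not_gt
    obtain ⟨r, hr, hr'⟩ := intermediate_value_Icc' hδt
      (hs.continuousOn_snd.mono fun s hs => hδ.le.trans hs.1) ⟨hc, (hpos δ hδ le_rfl).le⟩
    exact hne r (hδ.trans_le hr.1) hr'
  have hmono : MonotoneOn x (Ici 0) := by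
    refine monotoneOn_of_deriv_nonneg (convex_Ici 0) hs.continuousOn_fst ?_ ?_
    · intro t ht
      rw [interior_Ici] at ht
      exact (hs.hasDerivAt_fst ht).differentiableAt.differentiableWithinAt
    · intro t ht
      rw [interior_Ici] at ht
      rw [(hs.hasDerivAt_fst ht).deriv]
      exact (hy t ht).le
  obtain ⟨l, hl⟩ : ∃ l, Tendsto x atTop (𝓝 l) := by
    have hm : Monotone fun t => x (max t 0) := fun s t hst =>
      hmono (mem_Ici.2 (le_max_right _ _)) (mem_Ici.2 (le_max_right _ _)) (max_le_max_right _ hst)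
    have hb : BddAbove (range fun t => x (max t 0)) :=
      ⟨α, by rintro _ ⟨t, rfl⟩; exact (hs.mem_Ioo h (le_max_right _ _)).2.le⟩
    refine ⟨_, (tendsto_atTop_ciSup hm hb).congr' ?_⟩
    filter_upwards [eventually_ge_atTop 0] with t ht
    rw [max_eq_left ht]
  have hyt : Tendsto y atTop
      (𝓝 (√(2 * ((∫ s in (0 : ℝ)..l, f s) - ∫ s in (0 : ℝ)..ξ, f s)))) := by
    have := (((h.continuous_integral.tendsto l).comp hl).sub_const
      (∫ s in (0 : ℝ)..ξ, f s)).const_mul 2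
    refine (this.sqrt).congr' ?_
    filter_upwards [eventually_gt_atTop 0] with t ht
    simp only [Function.comp_apply]
    rw [← hs.energy h ht.le, Real.sqrt_sq (hy t ht).le]
  have h1 := eq_zero_of_tendsto_of_tendsto_deriv (fun r hr => hs.hasDerivAt_fst hr) hl hyt
  have h2 := eq_zero_of_tendsto_of_tendsto_deriv (fun r hr => hs.hasDerivAt_snd hr) hyt
    ((h.continuous.tendsto l).comp hl)
  have hlα : l ≤ α := le_of_tendsto hl <| by
    filter_upwards [eventually_ge_atTop 0] with t ht using (hs.mem_Ioo h ht).2.le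
  have hlξ : ξ ≤ l := ge_of_tendsto hl <| by
    filter_upwards [eventually_ge_atTop 0] with t ht using hs.start_le h ht
  have h3 : ∫ s in (0 : ℝ)..l, f s ≤ ∫ s in (0 : ℝ)..ξ, f s := by
    rw [Real.sqrt_eq_zero'] at h1
    linarith
  have h4 : ∫ s in (0 : ℝ)..ξ, f s ≤ ∫ s in (0 : ℝ)..l, f s := by
    refine ge_of_tendsto ((h.continuous_integral.tendsto l).comp hl) ?_
    filter_upwards [eventually_ge_atTop 0] with t ht
    have := hs.energy h ht
    simp only [Function.comp_apply]
    nlinarith [sq_nonneg (y t)]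
  rcases lt_trichotomy l 0 with hl0 | rfl | hl0
  · exact (h.pos l (h.lt_start.trans_le hlξ) hl0).ne' h2
  · have := h.integral_start_neg
    simp only [intervalIntegral.integral_same] at h3
    linarith
  · rcases hlα.lt_or_eq with hlt | rfl
    · exact (h.neg l hl0 hlt).ne h2
    · exact absurd h4 h.rim_lt.not_ge

theorem exists_first_critical (hs : IsGlobalSolution f x y ξ) (h : IsPotentialWell f α ξ) :
    ∃ r > 0, y r = 0 ∧ ∀ t, 0 < t → t < r → y t ≠ 0 := by
  obtain ⟨δ, hδ, hpos⟩ := hs.exists_pos_snd_near_zero h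
  obtain ⟨t₀, ht₀, hyt₀⟩ := hs.exists_snd_eq_zero h
  set Z := Ici δ ∩ y ⁻¹' {0} with hZ
  have hmem : ∀ t, 0 < t → y t = 0 → t ∈ Z := fun t ht hyt =>
    ⟨by
      by_contra hlt
      exact (hpos t ht (not_le.1 hlt).le).ne' hyt, hyt⟩
  have hclosed : IsClosed Z :=
    (hs.continuousOn_snd.mono (Ici_subset_Ici.2 hδ.le)).preimage_isClosed_of_isClosed isClosed_Ici
      isClosed_singleton
  have hbdd : BddBelow Z := ⟨δ, fun t ht => ht.1⟩
  have hinf := hclosed.csInf_mem ⟨t₀, hmem t₀ ht₀ hyt₀⟩ hbdd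
  exact ⟨sInf Z, hδ.trans_le hinf.1, hinf.2, fun t ht htr hyt =>
    (csInf_le hbdd (hmem t ht hyt)).not_gt htr⟩

theorem shift_eq {K : NNReal} (hf : LipschitzWith K f) (hs : IsGlobalSolution f x y ξ) {r : ℝ}
    (hr : 0 < r) (hyr : y r = 0) {t : ℝ} (ht : 0 ≤ t) : x (t + 2 * r) = x t := by
  have hneg : ∀ s, HasDerivAt (fun s : ℝ => 2 * r - s) (-1) s := fun s =>
    (hasDerivAt_id s).const_sub (2 * r)
  have hmaps : MapsTo (fun s : ℝ => 2 * r - s) (Icc r (2 * r)) (Ici 0) := fun s hs =>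
    sub_nonneg.2 hs.2
  have hrefl : IsForwardSolution f (fun s => x (2 * r - s)) (fun s => -y (2 * r - s)) r (2 * r) :=
    { continuousOn_fst := hs.continuousOn_fst.comp (by fun_prop) hmaps
      continuousOn_snd := (hs.continuousOn_snd.comp (by fun_prop) hmaps).neg
      deriv_fst := fun s hs' => by
        have := (hs.hasDerivAt_fst (sub_pos.2 hs'.2)).comp s (hneg s)
        exact (this.congr_deriv (by ring)).hasDerivWithinAt
      deriv_snd := fun s hs' => by
        have := ((hs.hasDerivAt_snd (sub_pos.2 hs'.2)).comp s (hneg s)).neg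
        exact (this.congr_deriv (by ring)).hasDerivWithinAt }
  have h2 : 2 * r - r = r := by ring
  obtain ⟨hx, hy⟩ := (hs.isForwardSolution hr.le).eqOn hf hrefl (by simp only [h2])
    (by simp only [h2, hyr, neg_zero])
  have hx2 := hx (right_mem_Icc.2 (by linarith))
  have hy2 := hy (right_mem_Icc.2 (by linarith))
  simp only [sub_self, hs.snd_zero, neg_zero] at hx2 hy2
  have hshift : IsForwardSolution f (fun s => x (s + 2 * r)) (fun s => y (s + 2 * r)) 0 t :=
    .of_hasDerivWithinAt fun s hs' => by
      have hp : 0 < s + 2 * r := by linarith [hs'.1]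
      exact ⟨((hs.hasDerivAt_fst hp).comp_add_const s (2 * r)).hasDerivWithinAt,
        ((hs.hasDerivAt_snd hp).comp_add_const s (2 * r)).hasDerivWithinAt⟩
  refine (hshift.eqOn hf (hs.isForwardSolution le_rfl) ?_ ?_).1 (right_mem_Icc.2 ht)
  · simp only [zero_add, hx2]
  · simp only [zero_add, hy2, hs.snd_zero]

theorem oscillation {K : NNReal} (hf : LipschitzWith K f) (hs : IsGlobalSolution f x y ξ)
    (h : IsPotentialWell f α ξ) :
    (∀ M : ℝ, ∃ r, M ≤ r ∧ x r = 0) ∧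
    (∃ T > 0, ∀ r, 0 ≤ r → x (r + T) = x r) ∧
    (∃ r₂ > 0, y r₂ = 0 ∧ (∀ r, 0 < r → r < r₂ → y r ≠ 0) ∧ IsLocalMax x r₂ ∧
      sSup ((fun r => |x r|) '' Ici 0) = x r₂ ∧ x r₂ < α) := by
  obtain ⟨r, hr, hyr, hfirst⟩ := hs.exists_first_critical h
  have hper : ∀ t, 0 ≤ t → x (t + 2 * r) = x t := fun t ht => hs.shift_eq hf hr hyr ht
  have hα := h.lt_start
  have hξ := h.start_neg
  have hmem := hs.mem_Ioo h hr.le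
  have hlt : ξ < x r := by
    refine (hs.start_le h hr.le).lt_of_ne fun heq => ?_
    obtain ⟨c, hc, hc'⟩ := exists_hasDerivAt_eq_zero hr
      (hs.continuousOn_fst.mono Icc_subset_Ici_self) (hs.fst_zero.trans heq)
      (fun t ht => hs.hasDerivAt_fst ht.1)
    exact hfirst c hc.1 hc.2 hc'
  have hW : ∫ s in (0 : ℝ)..x r, f s = ∫ s in (0 : ℝ)..ξ, f s := by
    have := hs.energy h hr.le
    rw [hyr] at this
    linarith
  have hpos : 0 < x r := by
    by_contra! hle
    exact (h.strictMonoOn ⟨hα.le, hξ.le⟩ ⟨hmem.1.le, hle⟩ hlt).ne' hW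
  have hle : ∀ t, 0 ≤ t → x t ≤ x r := by
    intro t ht
    by_contra! hc
    have h1 := h.strictAntiOn ⟨hpos.le, hmem.2.le⟩ ⟨(hpos.trans hc).le, (hs.mem_Ioo h ht).2.le⟩ hc
    have h2 := hs.energy h ht
    simp only [hW] at h1
    nlinarith [sq_nonneg (y t)]
  have hξr : -ξ ≤ x r := by
    by_contra! hc
    have h1 := h.strictAntiOn ⟨hpos.le, hmem.2.le⟩ ⟨by linarith, by linarith⟩ hc
    simp only [hW] at h1
    exact absurd h.start_le h1.not_ge
  refine ⟨fun M => ?_, ⟨2 * r, by linarith, hper⟩, r, hr, hyr, hfirst, ?_, ?_, hmem.2⟩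
  · obtain ⟨z, hz, hz'⟩ := intermediate_value_Icc hr.le
      (hs.continuousOn_fst.mono Icc_subset_Ici_self)
      (show (0 : ℝ) ∈ Icc (x 0) (x r) from ⟨by rw [hs.fst_zero]; exact hξ.le, hpos.le⟩)
    have hn : ∀ n : ℕ, x (z + n * (2 * r)) = 0 := by
      intro n
      induction n with
      | zero => simpa using hz'
      | succ n ih =>
        rw [← ih, ← hper (z + n * (2 * r)) (add_nonneg hz.1 (by positivity))]
        congr 1
        push_cast
        ring
    obtain ⟨n, hn'⟩ := exists_nat_ge (M / (2 * r))
    rw [div_le_iff₀ (by linarith)] at hn'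
    exact ⟨z + n * (2 * r), by linarith [hz.1], hn n⟩
  · filter_upwards [Ici_mem_nhds hr] with t ht using hle t ht
  · refine IsGreatest.csSup_eq ⟨⟨r, hr.le, abs_of_pos hpos⟩, ?_⟩
    rintro _ ⟨t, ht, rfl⟩
    exact abs_le.2 ⟨by linarith [hs.start_le h ht], hle t ht⟩

end IsGlobalSolution

theorem LocallyLipschitz.exists_lipschitzWith_bounded_eqOn {F : ℝ → ℝ} (hF : LocallyLipschitz F)
    {a b : ℝ} (hab : a ≤ b) :
    ∃ (f : ℝ → ℝ) (K L : NNReal), LipschitzWith K f ∧ (∀ t, |f t| ≤ L) ∧ EqOn f F (Icc a b) := by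
  obtain ⟨K, hK⟩ := (hF.locallyLipschitzOn (s := Icc a b)).exists_lipschitzOnWith_of_compact
    isCompact_Icc
  obtain ⟨C, hC⟩ := isCompact_Icc.exists_bound_of_continuousOn
    (hF.continuous.continuousOn (s := Icc a b))
  refine ⟨IccExtend hab ((Icc a b).domRestrict F), K * 1, C.toNNReal,
    hK.to_restrict.comp (LipschitzWith.projIcc hab), fun t => ?_, fun t ht => ?_⟩
  · exact (hC _ (projIcc a b hab t).2).trans (Real.le_coe_toNNReal C)
  · rw [IccExtend_of_mem hab _ ht, domRestrict_apply]

theorem IsPotentialWell.congr {f F : ℝ → ℝ} {α ξ : ℝ} (hF : IsPotentialWell F α ξ)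
    (hf : Continuous f) (heq : EqOn f F (Icc (-α) α)) : IsPotentialWell f α ξ := by
  have h1 := hF.lt_start
  have h2 := hF.start_neg
  have hint : ∀ t ∈ Icc (-α) α, ∫ s in (0 : ℝ)..t, f s = ∫ s in (0 : ℝ)..t, F s := fun t ht =>
    intervalIntegral.integral_congr fun s hs =>
      heq (ordConnected_Icc.uIcc_subset ⟨by linarith, by linarith⟩ ht hs)
  exact
    { continuous := hf
      pos := fun t ht ht0 => (hF.pos t ht ht0).trans_eq (heq ⟨ht.le, by linarith⟩).symm
      neg := fun t ht0 ht => (heq ⟨by linarith, ht.le⟩).trans_lt (hF.neg t ht0 ht)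
      lt_start := h1
      start_neg := h2
      rim_lt := by
        rw [hint α ⟨by linarith, le_rfl⟩, hint ξ ⟨h1.le, by linarith⟩]
        exact hF.rim_lt
      start_le := by
        rw [hint ξ ⟨h1.le, by linarith⟩, hint (-ξ) ⟨by linarith, by linarith⟩]
        exact hF.start_le }

theorem contDiffOn_two_of_solution {f x y : ℝ → ℝ} {s : Set ℝ} (hs : IsOpen s) (hf : Continuous f)
    (h : ∀ t ∈ s, HasDerivAt x (y t) t ∧ HasDerivAt y (f (x t)) t) : ContDiffOn ℝ 2 x s := by
  have hx : DifferentiableOn ℝ x s := fun t ht => (h t ht).1.differentiableAt.differentiableWithinAt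
  have hy : DifferentiableOn ℝ y s := fun t ht => (h t ht).2.differentiableAt.differentiableWithinAt
  have hx1 : ContDiffOn ℝ 1 y s := by
    rw [show (1 : WithTop ℕ∞) = 0 + 1 from rfl, contDiffOn_succ_iff_deriv_of_isOpen hs]
    refine ⟨hy, by simp, contDiffOn_zero.2 ?_⟩
    exact (hf.comp_continuousOn hx.continuousOn).congr fun t ht => (h t ht).2.deriv
  rw [show (2 : WithTop ℕ∞) = 1 + 1 from rfl, contDiffOn_succ_iff_deriv_of_isOpen hs]
  exact ⟨hx, by simp, hx1.congr fun t ht => (h t ht).1.deriv⟩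

theorem pucci_add_eq_zero_iff {lam Lam : ℝ} (hlam : 0 < lam) (hlamLam : lam ≤ Lam) (d s : ℝ) :
    (if 0 ≤ d then lam * d else Lam * d) + s = 0 ↔ d = max (-s / Lam) (-s / lam) := by
  have hLam := hlam.trans_le hlamLam
  rcases le_or_gt s 0 with hs | hs
  · rw [max_eq_right (div_le_div_of_nonneg_left (neg_nonneg.2 hs) hlam hlamLam)]
    split_ifs with hd
    · rw [eq_div_iff hlam.ne']
      constructor <;> intro h <;> linarith
    · have h1 : Lam * d < 0 := mul_neg_of_pos_of_neg hLam (not_le.1 hd)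
      have h2 : 0 ≤ -s / lam := div_nonneg (neg_nonneg.2 hs) hlam.le
      constructor <;> intro h <;> linarith
  · have hle : -s / lam ≤ -s / Lam := by
      rw [neg_div, neg_div]
      exact neg_le_neg (div_le_div_of_nonneg_left hs.le hlam hlamLam)
    rw [max_eq_left hle]
    split_ifs with hd
    · have h1 : 0 ≤ lam * d := mul_nonneg hlam.le hd
      have h2 : -s / Lam < 0 := div_neg_of_neg_of_pos (neg_lt_zero.2 hs) hLam
      constructor <;> intro h <;> linarith
    · rw [eq_div_iff hLam.ne']
      constructor <;> intro h <;> linarith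

theorem isPotentialWell_pucci {lam Lam : ℝ} (hlam : 0 < lam) (hlamLam : lam ≤ Lam) {g : ℝ → ℝ}
    (hgc : Continuous g) (hodd : ∀ t, g (-t) = -g t) {α ξ : ℝ} (hpos : ∀ t, 0 < t → t < α → 0 < g t)
    (hξα : -α < ξ) (hξ0 : ξ < 0)
    (hlt : Lam * ∫ s in (0 : ℝ)..ξ, g s < lam * ∫ s in (0 : ℝ)..α, g s) :
    IsPotentialWell (fun t => max (-g t / Lam) (-g t / lam)) α ξ := by
  have hLam := hlam.trans_le hlamLam
  have hα : 0 < α := by linarith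
  have hnonneg : ∀ t ∈ Icc 0 α, 0 ≤ g t := by
    have : closure (Ioo 0 α) ⊆ g ⁻¹' Ici 0 :=
      closure_minimal (fun t ht => (hpos t ht.1 ht.2).le) (isClosed_Ici.preimage hgc)
    rwa [closure_Ioo hα.ne] at this
  have hright : ∀ s, 0 ≤ s → max (-s / Lam) (-s / lam) = -s / Lam := fun s hs => by
    refine max_eq_left ?_
    rw [neg_div, neg_div]
    exact neg_le_neg (div_le_div_of_nonneg_left hs hlam hlamLam)
  have hleft : ∀ s, 0 ≤ s → max (- -s / Lam) (- -s / lam) = s / lam := fun s hs => by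
    rw [neg_neg]
    exact max_eq_right (div_le_div_of_nonneg_left hs hlam hlamLam)
  have hIr : ∀ t ∈ Icc 0 α, ∫ s in (0 : ℝ)..t, max (-g s / Lam) (-g s / lam) =
      -(∫ s in (0 : ℝ)..t, g s) / Lam := fun t ht => by
    rw [← intervalIntegral.integral_neg, ← intervalIntegral.integral_div]
    refine intervalIntegral.integral_congr fun s hs => ?_
    rw [uIcc_of_le ht.1] at hs
    exact hright _ (hnonneg s ⟨hs.1, hs.2.trans ht.2⟩)
  have hIl : ∀ t ∈ Icc 0 α, ∫ s in (0 : ℝ)..(-t), max (-g s / Lam) (-g s / lam) =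
      -(∫ s in (0 : ℝ)..t, g s) / lam := fun t ht => by
    have h1 := intervalIntegral.integral_comp_neg (a := 0) (b := t)
      (fun s => max (-g s / Lam) (-g s / lam))
    rw [neg_zero] at h1
    rw [intervalIntegral.integral_symm (-t) 0, ← h1, neg_div, ← intervalIntegral.integral_div]
    congr 1
    refine intervalIntegral.integral_congr fun s hs => ?_
    rw [uIcc_of_le ht.1] at hs
    simp only [hodd]
    exact hleft _ (hnonneg s ⟨hs.1, hs.2.trans ht.2⟩)
  have hξm : -ξ ∈ Icc 0 α := ⟨by linarith, by linarith⟩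
  have hGeven : ∫ s in (0 : ℝ)..ξ, g s = ∫ s in (0 : ℝ)..(-ξ), g s := by
    have h1 := intervalIntegral.integral_comp_neg (a := 0) (b := ξ) g
    simp only [hodd, intervalIntegral.integral_neg, neg_zero] at h1
    rw [intervalIntegral.integral_symm (-ξ) 0, ← h1, neg_neg]
  have hG0 : 0 ≤ ∫ s in (0 : ℝ)..(-ξ), g s :=
    intervalIntegral.integral_nonneg hξm.1 fun s hs => hnonneg s ⟨hs.1, hs.2.trans hξm.2⟩
  have hIξ := hIl (-ξ) hξm
  rw [neg_neg] at hIξ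
  rw [hGeven] at hlt
  exact
    { continuous := by fun_prop
      pos := fun t ht ht0 => by
        have := hpos (-t) (by linarith) (by linarith)
        rw [hodd] at this
        exact lt_max_of_lt_right (div_pos this hlam)
      neg := fun t ht0 ht => by
        have := neg_lt_zero.2 (hpos t ht0 ht)
        exact max_lt (div_neg_of_neg_of_pos this hLam) (div_neg_of_neg_of_pos this hlam)
      lt_start := hξα
      start_neg := hξ0
      rim_lt := by
        rw [hIr α ⟨hα.le, le_rfl⟩, hIξ, neg_div, neg_div, neg_lt_neg_iff, div_lt_div_iff₀ hlam hLam]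
        linarith
      start_le := by
        rw [hIr (-ξ) hξm, hIξ, neg_div, neg_div, neg_le_neg_iff]
        exact div_le_div_of_nonneg_left hG0 hlam hlamLam }

theorem hasDerivWithinAt_of_pucci {F u : ℝ → ℝ} {R : EReal} (hR : 0 < R)
    (hu : ContDiffOn ℝ 2 u {r : ℝ | 0 ≤ r ∧ (r : EReal) < R})
    (hode : ∀ r : ℝ, 0 ≤ r → (r : EReal) < R → deriv (deriv u) r = F (u r))
    (h0 : F (u 0) ≠ 0) {r : ℝ} (hr : 0 ≤ r) (hrR : (r : EReal) < R) :
    HasDerivWithinAt u (deriv u r) (Ici 0) r ∧ HasDerivWithinAt (deriv u) (F (u r)) (Ici 0) r := by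
  set O : Set ℝ := {r : ℝ | 0 < r ∧ (r : EReal) < R} with hO
  have hR' : IsOpen {r : ℝ | (r : EReal) < R} := isOpen_Iio.preimage continuous_coe_real_ereal
  have hOo : IsOpen O := isOpen_Ioi.inter hR'
  have huO : ContDiffOn ℝ (1 + 1) u O := hu.mono fun t ht => ⟨ht.1.le, ht.2⟩
  rw [contDiffOn_succ_iff_deriv_of_isOpen hOo] at huO
  obtain ⟨hd, -, hd2⟩ := huO
  rcases hr.eq_or_lt with rfl | hr
  · have h2 := hode 0 le_rfl hR
    have hdd : DifferentiableAt ℝ (deriv u) 0 := differentiableAt_of_deriv_ne_zero (by rwa [h2])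
    refine ⟨?_, by simpa only [h2] using hdd.hasDerivAt.hasDerivWithinAt⟩
    refine hasDerivWithinAt_Ici_of_tendsto_deriv hd
      ((hu.continuousOn 0 ⟨le_rfl, hR⟩).mono fun t ht => ⟨ht.1.le, ht.2⟩) ?_
      (hdd.continuousAt.tendsto.mono_left nhdsWithin_le_nhds)
    exact inter_mem self_mem_nhdsWithin (mem_nhdsWithin_of_mem_nhds (hR'.mem_nhds hR))
  · have hn : O ∈ 𝓝 r := hOo.mem_nhds ⟨hr, hrR⟩
    have h1 := (hd.differentiableAt hn).hasDerivAt
    have h2 := ((hd2.differentiableOn one_ne_zero).differentiableAt hn).hasDerivAt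
    rw [hode r hr.le hrR] at h2
    exact ⟨h1.hasDerivWithinAt, h2.hasDerivWithinAt⟩

theorem pucci_1d_minus_oscillating_case
    (lam Lam : ℝ) (hlam : 0 < lam) (hlamLam : lam ≤ Lam)
    (g : ℝ → ℝ) (hg1 : LocallyLipschitz g)
    (hg2 : ∀ t, g (-t) = - g t)
    (α : ℝ) (hα : 0 < α)
    (hg3pos : ∀ t, 0 < t → t < α → 0 < g t)
    (hg3neg : ∀ t, α < t → g t < 0)
    (G : ℝ → ℝ) (hG : ∀ t, G t = ∫ s in (0:ℝ)..t, g s)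
    (ξ : ℝ) (hξα : -α < ξ) (hξ0 : ξ < 0)
    (hGlt : Lam * G ξ < lam * G α)
    (R : EReal) (hR : 0 < R)
    (u : ℝ → ℝ)
    (hu : ContDiffOn ℝ 2 u {r : ℝ | 0 ≤ r ∧ (r : EReal) < R})
    (hode : ∀ r : ℝ, 0 ≤ r → (r : EReal) < R →
      (if 0 ≤ deriv (deriv u) r then lam * deriv (deriv u) r
        else Lam * deriv (deriv u) r) + g (u r) = 0)
    (hu0 : u 0 = ξ) (hu'0 : deriv u 0 = 0)
    (hmax : ¬ ∃ (R' : EReal) (v : ℝ → ℝ), R < R' ∧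
      ContDiffOn ℝ 2 v {r : ℝ | 0 ≤ r ∧ (r : EReal) < R'} ∧
      (∀ r : ℝ, 0 ≤ r → (r : EReal) < R' →
        (if 0 ≤ deriv (deriv v) r then lam * deriv (deriv v) r
        else Lam * deriv (deriv v) r) + g (v r) = 0) ∧
      v 0 = ξ ∧ deriv v 0 = 0 ∧
      (∀ r : ℝ, 0 ≤ r → (r : EReal) < R → v r = u r))
 :
    R = ⊤ ∧
    (∀ M : ℝ, ∃ r, M ≤ r ∧ u r = 0) ∧
    (∃ T > 0, ∀ r, 0 ≤ r → u (r + T) = u r) ∧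
    (∃ r₂ > 0, deriv u r₂ = 0 ∧
      (∀ r, 0 < r → r < r₂ → deriv u r ≠ 0) ∧
      IsLocalMax u r₂ ∧
      sSup ((fun r => |u r|) '' Set.Ici 0) = u r₂ ∧ u r₂ < α) := by
  rw [hG, hG] at hGlt
  have hwellF := isPotentialWell_pucci hlam hlamLam hg1.continuous hg2 hg3pos hξα hξ0 hGlt
  simp only [pucci_add_eq_zero_iff hlam hlamLam] at hode hmax
  have hFlip : LocallyLipschitz fun t => max (-g t / Lam) (-g t / lam) := by
    have hφ : ∀ c : ℝ, LocallyLipschitz fun s : ℝ => -s / c := fun c =>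
      ContDiff.locallyLipschitz (𝕂 := ℝ) (by fun_prop)
    exact ((hφ Lam).comp hg1).max ((hφ lam).comp hg1)
  set F : ℝ → ℝ := fun t => max (-g t / Lam) (-g t / lam) with hF
  obtain ⟨f, K, L, hfK, hfL, hfF⟩ :=
    hFlip.exists_lipschitzWith_bounded_eqOn (show -α ≤ α by linarith)
  have hwell := hwellF.congr hfK.continuous hfF
  have hsolF : ∀ r : ℝ, 0 ≤ r → (r : EReal) < R → HasDerivWithinAt u (deriv u r) (Ici 0) r ∧
      HasDerivWithinAt (deriv u) (F (u r)) (Ici 0) r := fun r hr hrR =>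
    hasDerivWithinAt_of_pucci hR hu hode (by rw [hu0]; exact (hwellF.pos ξ hξα hξ0).ne') hr hrR
  have hfu : ∀ r : ℝ, 0 ≤ r → (r : EReal) < R → f (u r) = F (u r) := fun r hr hrR =>
    hfF <| Ioo_subset_Icc_self <| hwellF.mem_Ioo (.of_hasDerivWithinAt fun t ht =>
      hsolF t ht.1 ((EReal.coe_le_coe_iff.2 ht.2).trans_lt hrR)) hu0 hu'0 ⟨hr, le_rfl⟩
  have hsol : ∀ r : ℝ, 0 ≤ r → (r : EReal) < R → HasDerivWithinAt u (deriv u r) (Ici 0) r ∧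
      HasDerivWithinAt (deriv u) (f (u r)) (Ici 0) r := fun r hr hrR => by
    rw [hfu r hr hrR]
    exact hsolF r hr hrR
  have hRtop : R = ⊤ := by
    by_contra hne
    lift R to ℝ using ⟨hne, (bot_le.trans_lt hR).ne'⟩
    have hR0 : 0 < R := EReal.coe_pos.1 hR
    obtain ⟨p, q, hp0, hq0, hpq⟩ :=
      exists_solution_of_lipschitz_bounded hfK hfL ⟨R + 1, by linarith⟩ ξ
    change ∀ t ∈ Ioo (-(R + 1)) (R + 1), _ at hpq
    have hpfwd : ∀ t, t < R + 1 → IsForwardSolution f p q 0 t := fun t ht =>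
      .of_hasDerivWithinAt fun s hs =>
        have := hpq s ⟨by linarith [hs.1], by linarith [hs.2]⟩
        ⟨this.1.hasDerivWithinAt, this.2.hasDerivWithinAt⟩
    have hup : ∀ t, 0 ≤ t → t < R → u t = p t := fun t ht htR =>
      (IsForwardSolution.eqOn hfK (.of_hasDerivWithinAt fun s hs =>
        hsol s hs.1 (EReal.coe_lt_coe_iff.2 (hs.2.trans_lt htR))) (hpfwd t (by linarith))
        (hu0.trans hp0.symm) (hu'0.trans hq0.symm)).1 (right_mem_Icc.2 ht)
    set v : ℝ → ℝ := fun r => if r < 0 then u r else p r with hv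
    have hvp : ∀ r, 0 ≤ r → v r = p r := fun r hr => if_neg hr.not_gt
    have hvu : ∀ r, r < R → v r = u r := fun r hr => by
      rcases lt_or_ge r 0 with h | h
      · exact if_pos h
      · rw [hvp r h, hup r h hr]
    have hvu0 : v =ᶠ[𝓝 0] u := by
      filter_upwards [Iio_mem_nhds hR0] with r hr using hvu r hr
    refine hmax ⟨(R + 1 : ℝ), v, EReal.coe_lt_coe_iff.2 (lt_add_one R), ?_, ?_,
      (hvu 0 hR0).trans hu0, hvu0.deriv_eq.trans hu'0,
      fun r _ hr => hvu r (EReal.coe_lt_coe_iff.1 hr)⟩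
    · have hc := contDiffOn_two_of_solution isOpen_Ioo hfK.continuous hpq
      refine (hc.mono fun r hr => ⟨by linarith [hr.1], EReal.coe_lt_coe_iff.1 hr.2⟩).congr
        fun r hr => hvp r hr.1
    · intro r hr hrR
      rw [EReal.coe_lt_coe_iff] at hrR
      rcases hr.eq_or_lt with rfl | hr
      · rw [hvu0.deriv.deriv_eq, hvu0.eq_of_nhds]
        exact hode 0 le_rfl hR
      · have hdv : deriv v =ᶠ[𝓝 r] q := by
          filter_upwards [Ioo_mem_nhds hr hrR] with s hs
          have hvps : v =ᶠ[𝓝 s] p := by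
            filter_upwards [Ioi_mem_nhds hs.1] with t ht using hvp t ht.le
          rw [hvps.deriv_eq, (hpq s ⟨by linarith [hs.1], hs.2⟩).1.deriv]
        rw [hdv.deriv_eq, (hpq r ⟨by linarith, hrR⟩).2.deriv, hvp r hr.le]
        exact hfF (Ioo_subset_Icc_self (hwell.mem_Ioo (hpfwd r hrR) hp0 hq0 ⟨hr.le, le_rfl⟩))
  subst hRtop
  have hglobal : IsGlobalSolution f u (deriv u) ξ :=
    ⟨hu0, hu'0, fun t ht => (hsol t ht (EReal.coe_lt_top t)).1,
      fun t ht => (hsol t ht (EReal.coe_lt_top t)).2⟩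
  exact ⟨rfl, hglobal.oscillation hfK hwell⟩
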